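/- Fix α ∈ ℝ and T > 0. There exist constants C > 0 and x₀ > 0, depending only on α and T, such that for all x ≥ x₀, all y ≥ 0, and all t ∈ (0, T], one has |p_t^α(x,y) − 𝔭_t(x−y) · (1 + exp(−2xy/t))| ≤ (C/x) · 𝔭_t(x−y). -/

import Mathlib

open MeasureTheory

/-- The standard Gaussian heat kernel `𝔭_s(u) = (2πs)^{-1/2} exp(-u²/(2s))`. -/
noncomputable def heatKernel (s u : ℝ) : ℝ :=
  (Real.sqrt (2 * Real.pi * s))⁻¹ * Real.exp (-(u ^ 2) / (2 * s))

/-- The Robin heat kernel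
`p_t^α(x,y) = 𝔭_t(x+y) + 𝔭_t(x−y) − 2(α − 1/2) ∫₀^∞ 𝔭_t(x+y+z) e^{−(α−1/2)z} dz`. -/
noncomputable def robinKernel (α t x y : ℝ) : ℝ :=
  heatKernel t (x + y) + heatKernel t (x - y) -
    2 * (α - 1 / 2) *
      ∫ z in Set.Ioi (0 : ℝ), heatKernel t (x + y + z) * Real.exp (-(α - 1 / 2) * z)

lemma hk_nonneg (s u : ℝ) : 0 ≤ heatKernel s u := by
  unfold heatKernel; positivity

lemma hk_sum (t x y : ℝ) (ht : 0 < t) :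
    heatKernel t (x + y) = heatKernel t (x - y) * Real.exp (-2 * x * y / t) := by
  unfold heatKernel
  rw [mul_assoc _ (Real.exp _), ← Real.exp_add]
  congr 2
  field_simp
  ring

lemma hk_bound (β t x y z T : ℝ) (ht : 0 < t) (htT : t ≤ T)
    (hx : 2 * T * (|β| + 1) ≤ x) (hy : 0 ≤ y) (hz : 0 < z) :
    heatKernel t (x + y + z) * Real.exp (-β * z) ≤
      heatKernel t (x - y) * Real.exp (-(x / (2 * t)) * z) := by
  unfold heatKernel
  rw [mul_assoc _ (Real.exp _), mul_assoc _ (Real.exp _), ← Real.exp_add, ← Real.exp_add]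
  refine mul_le_mul_of_nonneg_left ?_ (by positivity)
  apply Real.exp_le_exp.mpr
  have hb : 2 * t * |β| ≤ x := by nlinarith [abs_nonneg β]
  have hx0 : 0 ≤ x := by nlinarith [abs_nonneg β]
  have hb2 : 0 ≤ x + 2 * t * β := by nlinarith [neg_abs_le β]
  have h1 : -((x - y) ^ 2) / (2 * t) + -(x / (2 * t)) * z
      - (-((x + y + z) ^ 2) / (2 * t) + -β * z)
      = (4 * x * y + 2 * y * z + z ^ 2 + z * (x + 2 * t * β)) / (2 * t) := by
    field_simp
    ring
  have h2 : 0 ≤ (4 * x * y + 2 * y * z + z ^ 2 + z * (x + 2 * t * β)) / (2 * t) := by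
    have := mul_nonneg hz.le hb2
    positivity
  linarith

/-- Precise asymptotics: `p_t^α(x,y) = 𝔭_t(x−y)(1 + e^{−2xy/t} + O(x^{−1}))`,
uniformly in `y ≥ 0` and `t ∈ (0,T]`. -/
theorem robin_heat_kernel_asymptotics (α T : ℝ) (hT : 0 < T) :
    ∃ C : ℝ, 0 < C ∧ ∃ x₀ : ℝ, 0 < x₀ ∧ ∀ x : ℝ, x₀ ≤ x → ∀ y : ℝ, 0 ≤ y →
      ∀ t : ℝ, 0 < t → t ≤ T →
      |robinKernel α t x y - heatKernel t (x - y) * (1 + Real.exp (-2 * x * y / t))|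
        ≤ (C / x) * heatKernel t (x - y) := by
  refine ⟨4 * |α - 1 / 2| * T + 1, by positivity, 2 * T * (|α - 1 / 2| + 1), by positivity, ?_⟩
  intro x hx y hy t ht htT
  have hx0 : 0 < x := lt_of_lt_of_le (by positivity) hx
  have ha : -(x / (2 * t)) < 0 := by
    have : 0 < x / (2 * t) := by positivity
    linarith
  unfold robinKernel
  rw [hk_sum t x y ht]
  generalize α - 1 / 2 = β at *
  have hI : ‖∫ z in Set.Ioi (0 : ℝ), heatKernel t (x + y + z) * Real.exp (-β * z)‖ ≤
      ∫ z in Set.Ioi (0 : ℝ), heatKernel t (x - y) * Real.exp (-(x / (2 * t)) * z) := by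
    apply norm_integral_le_of_norm_le
    · exact (integrableOn_exp_mul_Ioi ha 0).const_mul _
    · refine (ae_restrict_iff' measurableSet_Ioi).mpr (Filter.Eventually.of_forall ?_)
      intro z hz
      rw [Real.norm_of_nonneg (mul_nonneg (hk_nonneg _ _) (Real.exp_pos _).le)]
      exact hk_bound β t x y z T ht htT hx hy hz
  rw [integral_const_mul, integral_exp_mul_Ioi ha 0, Real.norm_eq_abs] at hI
  generalize (∫ z in Set.Ioi (0 : ℝ), heatKernel t (x + y + z) * Real.exp (-β * z)) = I at *
  have hp := hk_nonneg t (x - y)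
  generalize heatKernel t (x - y) = p at *
  have e1 : p * Real.exp (-2 * x * y / t) + p - 2 * β * I
      - p * (1 + Real.exp (-2 * x * y / t)) = -(2 * β * I) := by ring
  have e2 : p * (-Real.exp (-(x / (2 * t)) * 0) / -(x / (2 * t))) = 2 * t * p / x := by
    rw [mul_zero, Real.exp_zero]
    field_simp
  rw [e2] at hI
  rw [e1, abs_neg, abs_mul, abs_mul, abs_two]
  calc 2 * |β| * |I| ≤ 2 * |β| * (2 * t * p / x) := by gcongr
    _ ≤ 2 * |β| * (2 * T * p / x) := by gcongr
    _ = (4 * |β| * T) / x * p := by ring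
    _ ≤ (4 * |β| * T + 1) / x * p := by gcongr; linarith
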